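/- arXiv:2511.21751 — 9 statements merged into one kernel-verified Lean document; each statement's English description precedes it below -/
import Mathlib

section
/- Let a : ℕ → ℝ be a real sequence with a n ≠ 0 for infinitely many indices n. Then there exists a connector sequence c : ℕ → ℝ such that the Hadamard product a ⊙ c satisfies liminf (a ⊙ c) = -∞ and limsup (a ⊙ c) = 0 (computed in the extended reals). -/
open Filter

/-- An infinite set of naturals has an infinite subset whose complement is infinite. -/
theorem Set.Infinite.exists_subset_infinite_compl {s : Set ℕ} (hs : s.Infinite) :
    ∃ t ⊆ s, t.Infinite ∧ tᶜ.Infinite := by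
  have hinj : Function.Injective (Nat.nth (· ∈ s)) := Nat.nth_injective hs
  refine ⟨Set.range fun k => Nat.nth (· ∈ s) (2 * k), ?_, ?_, ?_⟩
  · rintro _ ⟨k, rfl⟩
    exact Nat.nth_mem_of_infinite hs _
  · refine Set.infinite_range_of_injective fun i j hij => ?_
    have := hinj hij
    omega
  · refine Set.infinite_of_injective_forall_mem (f := fun k => Nat.nth (· ∈ s) (2 * k + 1))
      (fun i j hij => ?_) ?_
    · have := hinj hij
      omega
    · rintro k ⟨j, hj⟩
      have := hinj hj
      omega

theorem stmt1 (a : ℕ → ℝ) (h : {n : ℕ | a n ≠ 0}.Infinite) :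
    ∃ c : ℕ → ℝ,
      liminf (fun n => ((a n * c n : ℝ) : EReal)) atTop = ⊥ ∧
      limsup (fun n => ((a n * c n : ℝ) : EReal)) atTop = 0 := by
  classical
  obtain ⟨t, hts, ht, htc⟩ := h.exists_subset_infinite_compl
  have hc : ∀ n, a n * (if n ∈ t then -(n : ℝ) / a n else 0) = if n ∈ t then -(n : ℝ) else 0 := by
    intro n
    split_ifs with hn
    · exact mul_div_cancel₀ _ (hts hn)
    · simp
  refine ⟨fun n => if n ∈ t then -(n : ℝ) / a n else 0, ?_, ?_⟩ <;> simp only [hc]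
  · rw [EReal.eq_bot_iff_forall_lt]
    intro y
    refine lt_of_le_of_lt (b := ((y - 1 : ℝ) : EReal)) ?_ (EReal.coe_lt_coe_iff.2 (by linarith))
    refine liminf_le_of_frequently_le' ?_
    have hlarge : ∀ᶠ n : ℕ in atTop, 1 - y ≤ n := tendsto_natCast_atTop_atTop.eventually_ge_atTop _
    refine ((Nat.frequently_atTop_iff_infinite.2 ht).and_eventually hlarge).mono ?_
    rintro n ⟨hn, hny⟩
    rw [if_pos (show n ∈ t from hn), EReal.coe_le_coe_iff]
    linarith
  · apply le_antisymm
    · refine limsup_le_of_le (h := Eventually.of_forall fun n => ?_)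
      rw [← EReal.coe_zero, EReal.coe_le_coe_iff]
      split_ifs <;> simp
    · refine le_limsup_of_frequently_le' ((Nat.frequently_atTop_iff_infinite.2 htc).mono ?_)
      intro n hn
      rw [if_neg (show n ∉ t from hn), EReal.coe_zero]
end

section
/- Let a : ℕ → ℝ be a real sequence with a n ≠ 0 for infinitely many indices n. Then there exists a connector sequence c : ℕ → ℝ such that the Hadamard product a ⊙ c satisfies liminf (a ⊙ c) = -1 and limsup (a ⊙ c) = 1 (computed in the extended reals); in particular both are finite and the liminf is strictly less than the limsup. -/
open Filter

theorem limsup_coe_eq_of_frequently_eq {b : ℕ → ℝ} {M : ℝ} (hle : ∀ n, b n ≤ M)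
    (hfreq : ∃ᶠ n in atTop, b n = M) :
    limsup (fun n => (b n : EReal)) atTop = (M : EReal) :=
  le_antisymm
    (limsup_le_of_le (h := Eventually.of_forall fun n => EReal.coe_le_coe_iff.2 (hle n)))
    (le_limsup_of_frequently_le (hfreq.mono fun n hn => by rw [hn]))

theorem liminf_coe_eq_of_frequently_eq {b : ℕ → ℝ} {m : ℝ} (hle : ∀ n, m ≤ b n)
    (hfreq : ∃ᶠ n in atTop, b n = m) :
    liminf (fun n => (b n : EReal)) atTop = (m : EReal) :=
  le_antisymm
    (liminf_le_of_frequently_le (hfreq.mono fun n hn => by rw [hn]))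
    (le_liminf_of_le (h := Eventually.of_forall fun n => EReal.coe_le_coe_iff.2 (hle n)))

theorem stmt2 (a : ℕ → ℝ) (h : {n : ℕ | a n ≠ 0}.Infinite) :
    ∃ c : ℕ → ℝ,
      liminf (fun n => ((a n * c n : ℝ) : EReal)) atTop = ((-1 : ℝ) : EReal) ∧
      limsup (fun n => ((a n * c n : ℝ) : EReal)) atTop = ((1 : ℝ) : EReal) ∧
      liminf (fun n => ((a n * c n : ℝ) : EReal)) atTop <
        limsup (fun n => ((a n * c n : ℝ) : EReal)) atTop := by
  classical
  let p : ℕ → Prop := fun n => a n ≠ 0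
  have hp : {n | p n}.Infinite := h
  let c : ℕ → ℝ := fun n => (a n)⁻¹ * (-1) ^ Nat.count p n
  have habs : ∀ n, |a n * c n| ≤ 1 := by
    intro n
    by_cases hn : a n = 0
    · simp [hn]
    · simp [c, mul_inv_cancel_left₀ hn]
  have hnth : ∀ k, a (Nat.nth p k) * c (Nat.nth p k) = (-1) ^ k := by
    intro k
    have hk : a (Nat.nth p k) ≠ 0 := Nat.nth_mem_of_infinite hp k
    simp only [c, mul_inv_cancel_left₀ hk, Nat.count_nth_of_infinite hp]
  have hge : ∀ k, k ≤ Nat.nth p k := fun k => (Nat.nth_strictMono hp).le_apply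
  have hinf : liminf (fun n => ((a n * c n : ℝ) : EReal)) atTop = ((-1 : ℝ) : EReal) :=
    liminf_coe_eq_of_frequently_eq (fun n => (abs_le.1 (habs n)).1) <|
      frequently_atTop.2 fun N => ⟨Nat.nth p (2 * N + 1), by linarith [hge (2 * N + 1)], by
        rw [hnth, Odd.neg_one_pow ⟨N, rfl⟩]⟩
  have hsup : limsup (fun n => ((a n * c n : ℝ) : EReal)) atTop = ((1 : ℝ) : EReal) :=
    limsup_coe_eq_of_frequently_eq (fun n => (abs_le.1 (habs n)).2) <|
      frequently_atTop.2 fun N => ⟨Nat.nth p (2 * N), by linarith [hge (2 * N)], by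
        rw [hnth, Even.neg_one_pow (even_two_mul N)]⟩
  refine ⟨c, hinf, hsup, ?_⟩
  rw [hinf, hsup, EReal.coe_lt_coe_iff]
  norm_num
end

section
/- Let a : ℕ → ℝ be a real sequence with a n ≠ 0 for infinitely many indices n. Then there exists a connector sequence c : ℕ → ℝ such that the Hadamard product a ⊙ c satisfies liminf (a ⊙ c) = 0 and limsup (a ⊙ c) = +∞ (computed in the extended reals). -/
open Filter

/-- A nonnegative real sequence that vanishes infinitely often and equals its index infinitely
often has lower limit `0` and upper limit `⊤`. -/
theorem liminf_eq_zero_and_limsup_eq_top_of_frequently {b : ℕ → ℝ} (hb : ∀ n, 0 ≤ b n)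
    (h_zero : ∃ᶠ n in atTop, b n = 0) (h_index : ∃ᶠ n in atTop, b n = n) :
    liminf (fun n => (b n : EReal)) atTop = 0 ∧ limsup (fun n => (b n : EReal)) atTop = ⊤ := by
  refine ⟨le_antisymm ?_ ?_, ?_⟩
  · exact liminf_le_of_frequently_le' (h_zero.mono fun n hn => by simp [hn])
  · exact le_liminf_of_le (h := Eventually.of_forall fun n => by exact_mod_cast hb n)
  · rw [EReal.eq_top_iff_forall_lt]
    intro y
    refine lt_of_lt_of_le (b := ((y + 1 : ℝ) : EReal)) (by exact_mod_cast lt_add_one y) ?_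
    refine le_limsup_of_frequently_le' ((h_index.and_eventually
      (tendsto_natCast_atTop_atTop.eventually_ge_atTop (y + 1))).mono fun n hn => ?_)
    rw [hn.1]
    exact_mod_cast hn.2

theorem stmt3 (a : ℕ → ℝ) (h : {n : ℕ | a n ≠ 0}.Infinite) :
    ∃ c : ℕ → ℝ,
      liminf (fun n => ((a n * c n : ℝ) : EReal)) atTop = 0 ∧
      limsup (fun n => ((a n * c n : ℝ) : EReal)) atTop = ⊤ := by
  classical
  set e : ℕ → ℕ := Nat.nth fun n => a n ≠ 0
  have he : StrictMono e := Nat.nth_strictMono h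
  have hne (k : ℕ) : a (e k) ≠ 0 := Nat.nth_mem_of_infinite h k
  refine ⟨fun n => if ∃ k, n = e (2 * k) then n / a n else 0,
    liminf_eq_zero_and_limsup_eq_top_of_frequently (fun n => ?_) ?_ ?_⟩
  · dsimp only
    split_ifs with hn
    · obtain ⟨k, rfl⟩ := hn
      rw [mul_div_cancel₀ _ (hne _)]
      positivity
    · simp
  · refine frequently_atTop.2 fun N => ⟨e (2 * N + 1),
      by have := he.le_apply (x := 2 * N + 1); omega, ?_⟩
    dsimp only
    rw [if_neg, mul_zero]
    rintro ⟨k, hk⟩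
    have := he.injective hk
    omega
  · refine frequently_atTop.2 fun N => ⟨e (2 * N),
      by have := he.le_apply (x := 2 * N); omega, ?_⟩
    dsimp only
    rw [if_pos ⟨N, rfl⟩, mul_div_cancel₀ _ (hne _)]
end

section
/- Let a : ℕ → ℝ be a real sequence with a n ≠ 0 for infinitely many indices n. Then there exists a connector sequence c : ℕ → ℝ such that the Hadamard product a ⊙ c satisfies liminf (a ⊙ c) = -∞ and limsup (a ⊙ c) = +∞ (computed in the extended reals). -/
open Filter

/-- Every real sequence with infinitely many nonzero terms has a connector for which the product
takes the value `(-1) ^ k * k` at the `k`-th nonzero index. -/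
lemma exists_mul_nth_eq (a : ℕ → ℝ) (h : {n : ℕ | a n ≠ 0}.Infinite) :
    ∃ c : ℕ → ℝ, ∀ k : ℕ,
      a (Nat.nth (fun n => a n ≠ 0) k) * c (Nat.nth (fun n => a n ≠ 0) k) = (-1) ^ k * k := by
  classical
  refine ⟨fun n => (-1) ^ Nat.count (fun n => a n ≠ 0) n * Nat.count (fun n => a n ≠ 0) n / a n,
    fun k => ?_⟩
  have hk : a (Nat.nth (fun n => a n ≠ 0) k) ≠ 0 := Nat.nth_mem_of_infinite h k
  beta_reduce
  rw [Nat.count_nth_of_infinite h k, mul_div_cancel₀ _ hk]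

theorem stmt4 (a : ℕ → ℝ) (h : {n : ℕ | a n ≠ 0}.Infinite) :
    ∃ c : ℕ → ℝ,
      liminf (fun n => ((a n * c n : ℝ) : EReal)) atTop = ⊥ ∧
      limsup (fun n => ((a n * c n : ℝ) : EReal)) atTop = ⊤ := by
  obtain ⟨c, hc⟩ := exists_mul_nth_eq a h
  have le_nth (k : ℕ) : k ≤ Nat.nth (fun n => a n ≠ 0) k := (Nat.nth_strictMono h).le_apply
  refine ⟨c, (EReal.eq_bot_iff_forall_lt _).2 fun y => ?_,
    (EReal.eq_top_iff_forall_lt _).2 fun y => ?_⟩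
  · refine (liminf_le_of_frequently_le' (x := ((y - 1 : ℝ) : EReal)) ?_).trans_lt
      (EReal.coe_lt_coe_iff.2 (by linarith))
    refine frequently_atTop.2 fun N => ?_
    obtain ⟨m, hm⟩ := exists_nat_ge (1 - y)
    refine ⟨_, le_trans (by lia) (le_nth (2 * (m + N) + 1)), EReal.coe_le_coe_iff.2 ?_⟩
    rw [hc, Odd.neg_one_pow ⟨m + N, rfl⟩]
    push_cast
    linarith [m.cast_nonneg (α := ℝ), N.cast_nonneg (α := ℝ)]
  · refine (EReal.coe_lt_coe_iff.2 (lt_add_one y)).trans_le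
      (le_limsup_of_frequently_le' (x := ((y + 1 : ℝ) : EReal)) ?_)
    refine frequently_atTop.2 fun N => ?_
    obtain ⟨m, hm⟩ := exists_nat_ge (y + 1)
    refine ⟨_, le_trans (by lia) (le_nth (2 * (m + N))), EReal.coe_le_coe_iff.2 ?_⟩
    rw [hc, Even.neg_one_pow (even_two_mul _)]
    push_cast
    linarith [m.cast_nonneg (α := ℝ), N.cast_nonneg (α := ℝ)]
end

section
/- Each of the seven blocks A, B, C, D, E, F, G of the space of real sequences has cardinality equal to the continuum 𝔠 (the cardinality of ℝ). -/
open Filter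

noncomputable def L1 (a : ℕ → ℝ) : EReal := liminf (fun n => (a n : EReal)) atTop
noncomputable def L2 (a : ℕ → ℝ) : EReal := limsup (fun n => (a n : EReal)) atTop

def blockA : Set (ℕ → ℝ) := {a | L1 a = ⊥ ∧ ∃ x : ℝ, L2 a = (x : EReal)}
def blockB : Set (ℕ → ℝ) :=
  {a | ∃ x y : ℝ, L1 a = (x : EReal) ∧ L2 a = (y : EReal) ∧ x < y}
def blockC : Set (ℕ → ℝ) := {a | (∃ x : ℝ, L1 a = (x : EReal)) ∧ L2 a = ⊤}
def blockD : Set (ℕ → ℝ) := {a | L1 a = ⊥ ∧ L2 a = ⊤}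
def blockE : Set (ℕ → ℝ) := {a | L1 a = ⊥ ∧ L2 a = ⊥}
def blockF : Set (ℕ → ℝ) := {a | L1 a = ⊤ ∧ L2 a = ⊤}
def blockG : Set (ℕ → ℝ) := {a | ∃ x : ℝ, L1 a = (x : EReal) ∧ L2 a = (x : EReal)}

def blocks : Fin 7 → Set (ℕ → ℝ) :=
  ![blockA, blockB, blockC, blockD, blockE, blockF, blockG]

theorem exists_tendsto_coe_ereal (x : EReal) :
    ∃ p : ℕ → ℝ, Tendsto (fun n => (p n : EReal)) atTop (nhds x) := by
  induction x with
  | bot =>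
    exact ⟨fun n => -(n : ℝ), EReal.tendsto_coe_nhds_bot_iff.2
      (tendsto_neg_atTop_atBot.comp tendsto_natCast_atTop_atTop)⟩
  | coe x => exact ⟨fun _ => x, tendsto_const_nhds⟩
  | top => exact ⟨fun n => (n : ℝ), EReal.tendsto_coe_nhds_top_iff.2 tendsto_natCast_atTop_atTop⟩

theorem exists_L1_eq_L2_eq {x y : EReal} (h : x ≤ y) : ∃ a : ℕ → ℝ, L1 a = x ∧ L2 a = y := by
  obtain ⟨p, hp⟩ := exists_tendsto_coe_ereal x
  obtain ⟨q, hq⟩ := exists_tendsto_coe_ereal y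
  let s : Set ℕ := {n | Even n}
  let a : ℕ → ℝ := fun n => if Even n then p n else q n
  have : (atTop ⊓ 𝓟 s).NeBot := frequently_mem_iff_neBot.1 Nat.frequently_even
  have : (atTop ⊓ 𝓟 sᶜ).NeBot :=
    frequently_mem_iff_neBot.1 (Nat.frequently_odd.mono fun n hn => Nat.not_even_iff_odd.2 hn)
  have split : (atTop : Filter ℕ) = (atTop ⊓ 𝓟 s) ⊔ (atTop ⊓ 𝓟 sᶜ) := by
    rw [← inf_sup_left, sup_principal, Set.union_compl_self, principal_univ, inf_top_eq]
  have hx : Tendsto (fun n => (a n : EReal)) (atTop ⊓ 𝓟 s) (nhds x) := by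
    refine (hp.mono_left inf_le_left).congr' ?_
    filter_upwards [mem_inf_of_right (mem_principal_self s)] with n hn
    simp only [a, if_pos (show Even n from hn)]
  have hy : Tendsto (fun n => (a n : EReal)) (atTop ⊓ 𝓟 sᶜ) (nhds y) := by
    refine (hq.mono_left inf_le_left).congr' ?_
    filter_upwards [mem_inf_of_right (mem_principal_self sᶜ)] with n hn
    simp only [a, if_neg (show ¬ Even n from hn)]
  refine ⟨a, ?_, ?_⟩
  · rw [L1, split, liminf_sup_filter, hx.liminf_eq, hy.liminf_eq, inf_eq_left.2 h]
  · rw [L2, split, limsup_sup_filter, hx.limsup_eq, hy.limsup_eq, sup_eq_right.2 h]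

theorem coe_update_zero_eventuallyEq (a : ℕ → ℝ) (t : ℝ) :
    (fun n => (Function.update a 0 t n : EReal)) =ᶠ[atTop] fun n => (a n : EReal) := by
  filter_upwards [eventually_gt_atTop 0] with n hn
  rw [Function.update_of_ne hn.ne']

theorem L1_update_zero (a : ℕ → ℝ) (t : ℝ) : L1 (Function.update a 0 t) = L1 a :=
  liminf_congr (coe_update_zero_eventuallyEq a t)

theorem L2_update_zero (a : ℕ → ℝ) (t : ℝ) : L2 (Function.update a 0 t) = L2 a :=
  limsup_congr (coe_update_zero_eventuallyEq a t)

theorem mk_eq_continuum_of_L1_L2 (P : EReal → EReal → Prop) {x y : EReal} (h : x ≤ y)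
    (hP : P x y) : Cardinal.mk {a : ℕ → ℝ | P (L1 a) (L2 a)} = Cardinal.continuum := by
  obtain ⟨a, rfl, rfl⟩ := exists_L1_eq_L2_eq h
  apply le_antisymm
  · refine (Cardinal.mk_set_le _).trans_eq ?_
    simp [Cardinal.mk_real]
  · rw [← Cardinal.mk_real]
    refine Cardinal.mk_le_of_injective (f := fun t : ℝ =>
      (⟨Function.update a 0 t, ?_⟩ : {a : ℕ → ℝ | P (L1 a) (L2 a)})) ?_
    · simpa only [Set.mem_ofPred_eq, L1_update_zero, L2_update_zero] using hP
    · exact fun t u htu => Function.update_injective a 0 (congrArg Subtype.val htu)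

theorem stmt6 : ∀ i : Fin 7, Cardinal.mk (blocks i) = Cardinal.continuum := by
  intro i
  fin_cases i
  · exact mk_eq_continuum_of_L1_L2 (fun l u => l = ⊥ ∧ ∃ x : ℝ, u = (x : EReal))
      bot_le ⟨rfl, 0, rfl⟩
  · exact mk_eq_continuum_of_L1_L2
      (fun l u => ∃ x y : ℝ, l = (x : EReal) ∧ u = (y : EReal) ∧ x < y)
      (EReal.coe_le_coe_iff.2 zero_le_one) ⟨0, 1, rfl, rfl, zero_lt_one⟩
  · exact mk_eq_continuum_of_L1_L2 (fun l u => (∃ x : ℝ, l = (x : EReal)) ∧ u = ⊤)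
      le_top ⟨⟨0, rfl⟩, rfl⟩
  · exact mk_eq_continuum_of_L1_L2 (fun l u => l = ⊥ ∧ u = ⊤) bot_le ⟨rfl, rfl⟩
  · exact mk_eq_continuum_of_L1_L2 (fun l u => l = ⊥ ∧ u = ⊥) le_rfl ⟨rfl, rfl⟩
  · exact mk_eq_continuum_of_L1_L2 (fun l u => l = ⊤ ∧ u = ⊤) le_rfl ⟨rfl, rfl⟩
  · exact mk_eq_continuum_of_L1_L2 (fun l u => ∃ x : ℝ, l = (x : EReal) ∧ u = (x : EReal))
      le_rfl ⟨0, rfl, rfl⟩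
end

section
/- The linear subspace of ℕ → ℝ consisting of all real sequences converging to a finite limit has Hamel dimension (module rank over ℝ) equal to the continuum 𝔠. -/
open Filter

/-- Geometric sequences with distinct ratios are linearly independent. -/
theorem linearIndependent_geometric (R : Type*) [CommRing R] [IsDomain R] :
    LinearIndependent R (fun (r : R) (n : ℕ) => r ^ n) :=
  (linearIndependent_monoidHom (Multiplicative ℕ) R).comp (powersHom R)
    (powersHom R).injective

theorem stmt9 (S : Submodule ℝ (ℕ → ℝ))
    (hS : (S : Set (ℕ → ℝ)) =
      {a : ℕ → ℝ | ∃ L : ℝ, Tendsto a atTop (nhds L)}) :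
    Module.rank ℝ S = Cardinal.continuum := by
  apply le_antisymm
  · calc Module.rank ℝ S ≤ Module.rank ℝ (ℕ → ℝ) := S.rank_le
      _ ≤ Cardinal.mk (ℕ → ℝ) := rank_le_card ℝ (ℕ → ℝ)
      _ = Cardinal.continuum := by simp [Cardinal.mk_real]
  · have hmem (r : Set.Ioo (0 : ℝ) 1) : (fun n : ℕ => (r : ℝ) ^ n) ∈ S := by
      rw [← SetLike.mem_coe, hS]
      exact ⟨0, tendsto_pow_atTop_nhds_zero_of_lt_one r.2.1.le r.2.2⟩
    have hli : LinearIndependent ℝ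
        (fun r : Set.Ioo (0 : ℝ) 1 => (⟨fun n => (r : ℝ) ^ n, hmem r⟩ : S)) :=
      LinearIndependent.of_comp S.subtype
        ((linearIndependent_geometric ℝ).comp _ Subtype.val_injective)
    rw [← Cardinal.mk_Ioo_real (zero_lt_one' ℝ)]
    exact hli.cardinal_le_rank
end

section
/- Let M be a union of some of the seven blocks A, B, C, D, E, F, G of the space of real sequences. Then M is (the carrier of) a linear subspace of the real vector space ℕ → ℝ if and only if M = G, or M = B ∪ G, or M is the whole space ℕ → ℝ. -/
open Filter

lemma L1_le_L2 (a : ℕ → ℝ) : L1 a ≤ L2 a :=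
  liminf_le_limsup

lemma L1_neg (a : ℕ → ℝ) : L1 (-a) = -L2 a :=
  EReal.liminf_neg (v := fun n => (a n : EReal))

lemma L2_neg (a : ℕ → ℝ) : L2 (-a) = -L1 a :=
  EReal.limsup_neg (v := fun n => (a n : EReal))

lemma L2_eq_top_of_frequently {a : ℕ → ℝ} (h : ∀ c : ℝ, ∃ᶠ n in atTop, c ≤ a n) :
    L2 a = ⊤ :=
  (EReal.eq_top_iff_forall_lt _).2 fun c =>
    (EReal.coe_lt_coe_iff.2 (lt_add_one c)).trans_le <| le_limsup_of_frequently_le <|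
      (h (c + 1)).mono fun _ hn => EReal.coe_le_coe_iff.2 hn

lemma L1_eq_bot_of_frequently {a : ℕ → ℝ} (h : ∀ c : ℝ, ∃ᶠ n in atTop, a n ≤ c) :
    L1 a = ⊥ := by
  have key : L2 (-a) = ⊤ := L2_eq_top_of_frequently fun c =>
    (h (-c)).mono fun n hn => by simpa using le_neg_of_le_neg hn
  simpa [L2_neg] using key

lemma exists_eventually_le_of_L2_ne_top {a : ℕ → ℝ} (h : L2 a ≠ ⊤) :
    ∃ c : ℝ, ∀ᶠ n in atTop, a n ≤ c := by
  contrapose! h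
  exact L2_eq_top_of_frequently fun c => (h c).mono fun _ hn => hn.le

lemma exists_eventually_ge_of_L1_ne_bot {a : ℕ → ℝ} (h : L1 a ≠ ⊥) :
    ∃ c : ℝ, ∀ᶠ n in atTop, c ≤ a n := by
  contrapose! h
  exact L1_eq_bot_of_frequently fun c => (h c).mono fun _ hn => hn.le

lemma mem_blockF_iff {a : ℕ → ℝ} : a ∈ blockF ↔ Tendsto a atTop atTop := by
  rw [← EReal.tendsto_coe_nhds_top_iff]
  exact ⟨fun h => tendsto_of_le_liminf_of_limsup_le h.1.ge h.2.le,
    fun h => ⟨h.liminf_eq, h.limsup_eq⟩⟩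

lemma mem_blockG_iff {a : ℕ → ℝ} : a ∈ blockG ↔ ∃ x, Tendsto a atTop (nhds x) := by
  refine exists_congr fun x => ?_
  rw [← EReal.tendsto_coe]
  exact ⟨fun h => tendsto_of_le_liminf_of_limsup_le h.1.ge h.2.le,
    fun h => ⟨h.liminf_eq, h.limsup_eq⟩⟩

lemma mem_blockB_union_blockG_iff_ne {a : ℕ → ℝ} :
    a ∈ blockB ∪ blockG ↔ L1 a ≠ ⊥ ∧ L2 a ≠ ⊤ := by
  constructor
  · rintro (⟨x, y, hx, hy, -⟩ | ⟨x, hx, hy⟩) <;> simp [hx, hy]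
  · rintro ⟨h₁, h₂⟩
    have hle := L1_le_L2 a
    lift L1 a to ℝ using ⟨fun h => h₂ (top_le_iff.1 (h ▸ hle)), h₁⟩ with x hx
    lift L2 a to ℝ using ⟨h₂, fun h => by simp [h] at hle⟩ with y hy
    rcases (EReal.coe_le_coe_iff.1 hle).lt_or_eq with hlt | rfl
    · exact Or.inl ⟨x, y, hx.symm, hy.symm, hlt⟩
    · exact Or.inr ⟨x, hx.symm, hy.symm⟩

lemma mem_blockB_union_blockG_iff {a : ℕ → ℝ} :
    a ∈ blockB ∪ blockG ↔ ∃ c, ∀ᶠ n in atTop, |a n| ≤ c := by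
  rw [mem_blockB_union_blockG_iff_ne]
  constructor
  · rintro ⟨h₁, h₂⟩
    obtain ⟨c, hc⟩ := exists_eventually_ge_of_L1_ne_bot h₁
    obtain ⟨d, hd⟩ := exists_eventually_le_of_L2_ne_top h₂
    refine ⟨max (-c) d, ?_⟩
    filter_upwards [hc, hd] with n hcn hdn
    exact abs_le.2 ⟨by linarith [le_max_left (-c) d], hdn.trans (le_max_right _ _)⟩
  · rintro ⟨c, hc⟩
    have h₁ : ((-c : ℝ) : EReal) ≤ L1 a := le_liminf_of_le (by isBoundedDefault) <|
      hc.mono fun n hn => EReal.coe_le_coe_iff.2 (abs_le.1 hn).1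
    have h₂ : L2 a ≤ (c : EReal) := limsup_le_of_le (by isBoundedDefault) <|
      hc.mono fun n hn => EReal.coe_le_coe_iff.2 (abs_le.1 hn).2
    exact ⟨((EReal.bot_lt_coe _).trans_le h₁).ne', (h₂.trans_lt (EReal.coe_lt_top _)).ne⟩

lemma neg_mem_blockC {a : ℕ → ℝ} (h : a ∈ blockC) : -a ∈ blockA := by
  obtain ⟨⟨x, hx⟩, h₂⟩ := h
  exact ⟨by simp [L1_neg, h₂], -x, by simp [L2_neg, hx]⟩

lemma neg_mem_blockF {a : ℕ → ℝ} (h : a ∈ blockF) : -a ∈ blockE :=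
  ⟨by simp [L1_neg, h.2], by simp [L2_neg, h.1]⟩

lemma indicator_mem_blockC {a : ℕ → ℝ} (ha : Tendsto a atTop atTop) {t : Set ℕ}
    (ht : ∃ᶠ n in atTop, n ∈ t) (ht' : ∃ᶠ n in atTop, n ∉ t) : t.indicator a ∈ blockC := by
  refine ⟨⟨0, le_antisymm ?_ ?_⟩, L2_eq_top_of_frequently fun c => ?_⟩
  · exact liminf_le_of_frequently_le <| ht'.mono fun n hn => by simp [hn]
  · refine le_liminf_of_le (by isBoundedDefault) <| (ha.eventually_ge_atTop 0).mono fun n hn =>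
      EReal.coe_le_coe_iff.2 ?_
    by_cases h : n ∈ t <;> simp [h, hn]
  · exact (ht.and_eventually (ha.eventually_ge_atTop c)).mono fun n hn => by simpa [hn.1] using hn.2

lemma mem_blockD_of_alternating {a : ℕ → ℝ} (h : ∀ n : ℕ, Even n → (n : ℝ) ≤ a n)
    (h' : ∀ n : ℕ, ¬Even n → a n ≤ -n) : a ∈ blockD := by
  have hlim := tendsto_natCast_atTop_atTop (R := ℝ)
  refine ⟨L1_eq_bot_of_frequently fun c => ?_, L2_eq_top_of_frequently fun c => ?_⟩
  · refine (Nat.frequently_odd.and_eventually (hlim.eventually_ge_atTop (-c))).mono fun n hn => ?_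
    linarith [h' n (Nat.not_even_iff_odd.2 hn.1), hn.2]
  · exact (Nat.frequently_even.and_eventually (hlim.eventually_ge_atTop c)).mono fun n hn =>
      hn.2.trans (h n hn.1)

lemma eq_univ_of_blockF_subset {M : Set (ℕ → ℝ)} (hadd : ∀ a ∈ M, ∀ b ∈ M, a + b ∈ M)
    (hneg : ∀ a, -a ∈ M → a ∈ M) (h : blockF ⊆ M) : M = Set.univ := by
  refine Set.eq_univ_of_forall fun x => ?_
  have hlim := tendsto_natCast_atTop_atTop (R := ℝ)
  have hu : (fun n : ℕ => |x n| + n) ∈ blockF := mem_blockF_iff.2 <|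
    tendsto_atTop_mono (fun n => by linarith [abs_nonneg (x n)]) hlim
  have hxu : (x + fun n : ℕ => |x n| + n) ∈ blockF := mem_blockF_iff.2 <|
    tendsto_atTop_mono (fun n => by
      simp only [Pi.add_apply]; linarith [neg_abs_le (x n)]) hlim
  simpa using hadd _ (h hxu) _ (hneg (-fun n : ℕ => |x n| + n) (by simpa using h hu))

lemma blockF_subset_of_blockC_subset {M : Set (ℕ → ℝ)}
    (hadd : ∀ a ∈ M, ∀ b ∈ M, a + b ∈ M) (h : blockC ⊆ M) : blockF ⊆ M := by
  intro a ha
  have hlim := mem_blockF_iff.1 ha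
  have hodd : ∃ᶠ n : ℕ in atTop, n ∉ {n : ℕ | Even n} :=
    Nat.frequently_odd.mono fun n hn => Nat.not_even_iff_odd.2 hn
  have heven : ∃ᶠ n : ℕ in atTop, n ∉ {n : ℕ | Even n}ᶜ :=
    Nat.frequently_even.mono fun n hn => not_not.2 hn
  rw [← Set.indicator_self_add_compl {n : ℕ | Even n} a]
  exact hadd _ (h (indicator_mem_blockC hlim Nat.frequently_even hodd))
      _ (h (indicator_mem_blockC hlim hodd heven))

lemma eq_univ_of_blockD_subset {M : Set (ℕ → ℝ)} (hadd : ∀ a ∈ M, ∀ b ∈ M, a + b ∈ M)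
    (hneg : ∀ a, -a ∈ M → a ∈ M) (h : blockD ⊆ M) : M = Set.univ := by
  refine Set.eq_univ_of_forall fun x => ?_
  set u : ℕ → ℝ := fun n => if Even n then |x n| + n else -(|x n| + n) with hu
  have hu_mem : u ∈ blockD := mem_blockD_of_alternating
    (fun n hn => by simp [hu, hn])
    (fun n hn => by simp only [hu, hn, if_false]; linarith [abs_nonneg (x n)])
  have hxu : x + u ∈ blockD := mem_blockD_of_alternating
    (fun n hn => by simp only [hu, hn, if_true, Pi.add_apply]; linarith [neg_abs_le (x n)])
    (fun n hn => by simp only [hu, hn, if_false, Pi.add_apply]; linarith [le_abs_self (x n)])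
  simpa using hadd _ (h hxu) _ (hneg (-u) (by simpa using h hu_mem))

lemma eq_univ_of_unbounded_block_subset {M : Set (ℕ → ℝ)}
    (hadd : ∀ a ∈ M, ∀ b ∈ M, a + b ∈ M) (hneg : ∀ a, -a ∈ M → a ∈ M)
    (h : blockA ⊆ M ∨ blockC ⊆ M ∨ blockD ⊆ M ∨ blockE ⊆ M ∨ blockF ⊆ M) :
    M = Set.univ := by
  rcases h with h | h | h | h | h
  · exact eq_univ_of_blockF_subset hadd hneg <| blockF_subset_of_blockC_subset hadd
      fun a ha => hneg a (h (neg_mem_blockC ha))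
  · exact eq_univ_of_blockF_subset hadd hneg (blockF_subset_of_blockC_subset hadd h)
  · exact eq_univ_of_blockD_subset hadd hneg h
  · exact eq_univ_of_blockF_subset hadd hneg fun a ha => hneg a (h (neg_mem_blockF ha))
  · exact eq_univ_of_blockF_subset hadd hneg h

lemma mem_iUnion_blocks_iff {s : Set (Fin 7)} {a : ℕ → ℝ} :
    a ∈ ⋃ i ∈ s, blocks i ↔ (0 ∈ s ∧ a ∈ blockA) ∨ (1 ∈ s ∧ a ∈ blockB) ∨
      (2 ∈ s ∧ a ∈ blockC) ∨ (3 ∈ s ∧ a ∈ blockD) ∨ (4 ∈ s ∧ a ∈ blockE) ∨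
      (5 ∈ s ∧ a ∈ blockF) ∨ (6 ∈ s ∧ a ∈ blockG) := by
  simp only [Set.mem_iUnion, exists_prop]
  constructor
  · rintro ⟨i, hi, ha⟩
    fin_cases i <;> simp_all [blocks]
  · rintro (h | h | h | h | h | h | h)
    exacts [⟨0, h⟩, ⟨1, h⟩, ⟨2, h⟩, ⟨3, h⟩, ⟨4, h⟩, ⟨5, h⟩, ⟨6, h⟩]

lemma six_mem_of_zero_mem {s : Set (Fin 7)} (h : (0 : ℕ → ℝ) ∈ ⋃ i ∈ s, blocks i) : 6 ∈ s := by
  have h₁ : L1 0 = 0 := by simp [L1]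
  have h₂ : L2 0 = 0 := by simp [L2]
  rw [mem_iUnion_blocks_iff] at h
  rcases h with h | ⟨-, x, y, hx, hy, hxy⟩ | h | h | h | h | h
  · simp [blockA, h₁] at h
  · rw [h₁] at hx
    rw [h₂] at hy
    exact absurd (EReal.coe_eq_coe_iff.1 (hx.symm.trans hy)) hxy.ne
  · simp [blockC, h₂] at h
  · simp [blockD, h₁] at h
  · simp [blockE, h₁] at h
  · simp [blockF, h₁] at h
  · exact h.1

theorem stmt10 (M : Set (ℕ → ℝ)) (s : Set (Fin 7))
    (hM : M = ⋃ i ∈ s, blocks i) :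
    ((0 : ℕ → ℝ) ∈ M ∧
     (∀ a ∈ M, ∀ b ∈ M, a + b ∈ M) ∧
     (∀ (l : ℝ), ∀ a ∈ M, l • a ∈ M)) ↔
    (M = blockG ∨ M = blockB ∪ blockG ∨ M = Set.univ) := by
  constructor
  · rintro ⟨h0, hadd, hsmul⟩
    have h6 : 6 ∈ s := six_mem_of_zero_mem (hM ▸ h0)
    have hsub (i : Fin 7) (hi : i ∈ s) : blocks i ⊆ M := hM ▸ Set.subset_biUnion_of_mem hi
    have hneg (a : ℕ → ℝ) (ha : -a ∈ M) : a ∈ M := by simpa using hsmul (-1) (-a) ha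
    by_cases hs : 0 ∈ s ∨ 2 ∈ s ∨ 3 ∈ s ∨ 4 ∈ s ∨ 5 ∈ s
    · exact Or.inr <| Or.inr <| eq_univ_of_unbounded_block_subset hadd hneg <|
        hs.imp (hsub 0) <| Or.imp (hsub 2) <| Or.imp (hsub 3) <| Or.imp (hsub 4) (hsub 5)
    · push Not at hs
      obtain ⟨hs0, hs2, hs3, hs4, hs5⟩ := hs
      by_cases h1 : 1 ∈ s
      · refine Or.inr (Or.inl (Set.ext fun a => ?_))
        simp [mem_iUnion_blocks_iff, -Set.mem_iUnion, *]
      · refine Or.inl (Set.ext fun a => ?_)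
        simp [mem_iUnion_blocks_iff, -Set.mem_iUnion, *]
  · clear hM
    rintro (rfl | rfl | rfl)
    · simp only [mem_blockG_iff]
      exact ⟨⟨0, tendsto_const_nhds⟩, fun a ⟨x, hx⟩ b ⟨y, hy⟩ => ⟨x + y, hx.add hy⟩,
        fun l a ⟨x, hx⟩ => ⟨l • x, hx.const_smul l⟩⟩
    · simp only [mem_blockB_union_blockG_iff]
      refine ⟨⟨0, by simp⟩, fun a ⟨c, hc⟩ b ⟨d, hd⟩ => ⟨c + d, ?_⟩,
        fun l a ⟨c, hc⟩ => ⟨|l| * c, ?_⟩⟩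
      · filter_upwards [hc, hd] with n hcn hdn
        exact (abs_add_le _ _).trans (add_le_add hcn hdn)
      · filter_upwards [hc] with n hcn
        simpa [abs_mul] using mul_le_mul_of_nonneg_left hcn (abs_nonneg l)
    · simp
end

section
/- For each of the seven blocks X ∈ {A, B, C, D, E, F, G} of the space of real sequences, there exists an injective map from the complement (ℕ → ℝ) \ X into X. Consequently, for any two distinct blocks X and Y there exists an injective map from Y into X. -/
open Filter

open scoped Topology

/-- The sequence agreeing with `u` at even indices and with `v` at odd ones. -/
def interleave {α : Type*} (u v : ℕ → α) (n : ℕ) : α := if Even n then u n else v n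

theorem tendsto_interleave_even {α : Type*} {u : ℕ → α} {l : Filter α} (v : ℕ → α)
    (hu : Tendsto u atTop l) : Tendsto (interleave u v) (atTop ⊓ 𝓟 {n | Even n}) l := by
  refine (hu.mono_left inf_le_left).congr' ?_
  filter_upwards [mem_inf_of_right (mem_principal_self _)] with n hn
  exact (if_pos hn).symm

theorem tendsto_interleave_odd {α : Type*} {v : ℕ → α} {l : Filter α} (u : ℕ → α)
    (hv : Tendsto v atTop l) : Tendsto (interleave u v) (atTop ⊓ 𝓟 {n | Even n}ᶜ) l := by
  refine (hv.mono_left inf_le_left).congr' ?_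
  filter_upwards [mem_inf_of_right (mem_principal_self _)] with n hn
  exact (if_neg hn).symm

instance neBot_atTop_inf_even : (atTop ⊓ 𝓟 {n : ℕ | Even n}).NeBot :=
  frequently_mem_iff_neBot.1 Nat.frequently_even

instance neBot_atTop_inf_not_even : (atTop ⊓ 𝓟 {n : ℕ | Even n}ᶜ).NeBot :=
  frequently_mem_iff_neBot.1 <| frequently_atTop.2 fun n =>
    ⟨2 * n + 1, by omega, Nat.not_even_two_mul_add_one n⟩

theorem atTop_eq_even_sup_not_even :
    (atTop : Filter ℕ) = atTop ⊓ 𝓟 {n | Even n} ⊔ atTop ⊓ 𝓟 {n | Even n}ᶜ := by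
  rw [← inf_sup_left, sup_principal, Set.union_compl_self, principal_univ, inf_top_eq]

theorem liminf_interleave {α : Type*} [CompleteLinearOrder α] [TopologicalSpace α]
    [OrderTopology α] {u v : ℕ → α} {p q : α} (hu : Tendsto u atTop (𝓝 p))
    (hv : Tendsto v atTop (𝓝 q)) : liminf (interleave u v) atTop = p ⊓ q := by
  rw [atTop_eq_even_sup_not_even, liminf_sup_filter, (tendsto_interleave_even v hu).liminf_eq,
    (tendsto_interleave_odd u hv).liminf_eq]

theorem limsup_interleave {α : Type*} [CompleteLinearOrder α] [TopologicalSpace α]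
    [OrderTopology α] {u v : ℕ → α} {p q : α} (hu : Tendsto u atTop (𝓝 p))
    (hv : Tendsto v atTop (𝓝 q)) : limsup (interleave u v) atTop = p ⊔ q := by
  rw [atTop_eq_even_sup_not_even, limsup_sup_filter, (tendsto_interleave_even v hu).limsup_eq,
    (tendsto_interleave_odd u hv).limsup_eq]

/-- An injective encoding of real sequences as null sequences. -/
noncomputable def nullSeq (a : ℕ → ℝ) (n : ℕ) : ℝ := Real.arctan (a n) * (1 / ((n : ℝ) + 1))

theorem nullSeq_injective : Function.Injective nullSeq := by
  intro a b h
  funext n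
  have hn : (1 / ((n : ℝ) + 1)) ≠ 0 := by positivity
  exact Real.arctan_injective (mul_right_cancel₀ hn (congrFun h n))

theorem tendsto_nullSeq (a : ℕ → ℝ) : Tendsto (nullSeq a) atTop (𝓝 0) :=
  bdd_le_mul_tendsto_zero
    (Eventually.of_forall fun n => (Real.neg_pi_div_two_lt_arctan (a n)).le)
    (Eventually.of_forall fun n => (Real.arctan_lt_pi_div_two (a n)).le)
    tendsto_one_div_add_atTop_nhds_zero_nat

theorem coe_interleave (u v : ℕ → ℝ) :
    (fun n => ((interleave u v n : ℝ) : EReal)) = interleave (fun n => (u n : EReal)) fun n => v n := by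
  funext n
  exact apply_ite _ _ _ _

/-- If every null perturbation of `u` tends to `p` and every null perturbation of `v` tends to `q`,
then a set determined by these limits receives an injection from all real sequences. -/
theorem exists_injective_of_limits {X : Set (ℕ → ℝ)} {u v : ℕ → ℝ} {p q : EReal}
    (hu : ∀ w : ℕ → ℝ, Tendsto w atTop (𝓝 0) →
      Tendsto (fun n => ((u n + w n : ℝ) : EReal)) atTop (𝓝 p))
    (hv : ∀ w : ℕ → ℝ, Tendsto w atTop (𝓝 0) →
      Tendsto (fun n => ((v n + w n : ℝ) : EReal)) atTop (𝓝 q))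
    (hX : ∀ a, L1 a = p ⊓ q → L2 a = p ⊔ q → a ∈ X) :
    ∃ f : (ℕ → ℝ) → X, Function.Injective f := by
  let g (a : ℕ → ℝ) : ℕ → ℝ := interleave (u + nullSeq a) (v + nullSeq a)
  have hg : ∀ a, g a ∈ X := by
    intro a
    have h₁ := hu _ (tendsto_nullSeq a)
    have h₂ := hv _ (tendsto_nullSeq a)
    refine hX _ ?_ ?_
    · rw [L1, coe_interleave]
      exact liminf_interleave h₁ h₂
    · rw [L2, coe_interleave]
      exact limsup_interleave h₁ h₂
  refine ⟨fun a => ⟨g a, hg a⟩, fun a b h => nullSeq_injective (funext fun n => ?_)⟩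
  have hn : g a n = g b n := congrFun (congrArg Subtype.val h) n
  by_cases he : Even n <;> simpa [g, interleave, he] using hn

theorem tendsto_const_add_null (c : ℝ) (w : ℕ → ℝ) (hw : Tendsto w atTop (𝓝 0)) :
    Tendsto (fun n => ((c + w n : ℝ) : EReal)) atTop (𝓝 (c : EReal)) :=
  EReal.tendsto_coe.2 (by simpa using hw.const_add c)

theorem tendsto_natCast_add_null (w : ℕ → ℝ) (hw : Tendsto w atTop (𝓝 0)) :
    Tendsto (fun n : ℕ => (((n : ℝ) + w n : ℝ) : EReal)) atTop (𝓝 ⊤) :=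
  EReal.tendsto_coe_nhds_top_iff.2 (tendsto_natCast_atTop_atTop.atTop_add hw)

theorem tendsto_neg_natCast_add_null (w : ℕ → ℝ) (hw : Tendsto w atTop (𝓝 0)) :
    Tendsto (fun n : ℕ => ((-(n : ℝ) + w n : ℝ) : EReal)) atTop (𝓝 ⊥) :=
  EReal.tendsto_coe_nhds_bot_iff.2
    ((tendsto_neg_atTop_atBot.comp tendsto_natCast_atTop_atTop).atBot_add hw)

theorem exists_injective_block (i : Fin 7) :
    ∃ f : (ℕ → ℝ) → blocks i, Function.Injective f := by
  have zero := tendsto_const_add_null 0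
  have one := tendsto_const_add_null 1
  have top := tendsto_natCast_add_null
  have bot := tendsto_neg_natCast_add_null
  fin_cases i
  · exact exists_injective_of_limits bot zero fun _ h₁ h₂ =>
      ⟨by simpa using h₁, 0, by simpa using h₂⟩
  · exact exists_injective_of_limits zero one fun _ h₁ h₂ =>
      ⟨0, 1, by simpa using h₁, by simpa using h₂, one_pos⟩
  · exact exists_injective_of_limits zero top fun _ h₁ h₂ =>
      ⟨⟨0, by simpa using h₁⟩, by simpa using h₂⟩
  · exact exists_injective_of_limits bot top fun _ h₁ h₂ =>
      ⟨by simpa using h₁, by simpa using h₂⟩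
  · exact exists_injective_of_limits bot bot fun _ h₁ h₂ =>
      ⟨by simpa using h₁, by simpa using h₂⟩
  · exact exists_injective_of_limits top top fun _ h₁ h₂ =>
      ⟨by simpa using h₁, by simpa using h₂⟩
  · exact exists_injective_of_limits zero zero fun _ h₁ h₂ =>
      ⟨0, by simpa using h₁, by simpa using h₂⟩

theorem stmt12 :
    (∀ i : Fin 7,
      ∃ f : ↥((blocks i)ᶜ) → ↥(blocks i), Function.Injective f) ∧
    (∀ i j : Fin 7, i ≠ j →
      ∃ f : ↥(blocks j) → ↥(blocks i), Function.Injective f) := by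
  have restrict (i : Fin 7) (S : Set (ℕ → ℝ)) : ∃ f : S → blocks i, Function.Injective f := by
    obtain ⟨f, hf⟩ := exists_injective_block i
    exact ⟨f ∘ Subtype.val, hf.comp Subtype.val_injective⟩
  exact ⟨fun i => restrict i _, fun i j _ => restrict i _⟩
end

section
/- Each of the five blocks A, B, C, D, G contains a sequence a such that for every connector c : ℕ → ℝ, the Hadamard product a ⊙ c neither tends to +∞ nor tends to -∞; in particular, a ⊙ c never belongs to block E or block F. Hence none of A, B, C, D, G is connected to E or to F under the Hadamard product. -/
open Filter

theorem L1_eq_coe {a : ℕ → ℝ} {x : ℝ} (h : ∀ n, x ≤ a n) (hf : ∃ᶠ n in atTop, a n ≤ x) :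
    L1 a = (x : EReal) :=
  le_antisymm
    (liminf_le_of_frequently_le (hf.mono fun _ hn => EReal.coe_le_coe_iff.2 hn))
    (le_liminf_of_le (h := Eventually.of_forall fun n => EReal.coe_le_coe_iff.2 (h n)))

theorem L2_eq_coe {a : ℕ → ℝ} {x : ℝ} (h : ∀ n, a n ≤ x) (hf : ∃ᶠ n in atTop, x ≤ a n) :
    L2 a = (x : EReal) :=
  le_antisymm
    (limsup_le_of_le (h := Eventually.of_forall fun n => EReal.coe_le_coe_iff.2 (h n)))
    (le_limsup_of_frequently_le (hf.mono fun _ hn => EReal.coe_le_coe_iff.2 hn))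

theorem L1_eq_bot {a : ℕ → ℝ} (h : ∀ M : ℝ, ∃ᶠ n in atTop, a n < M) : L1 a = ⊥ := by
  refine (EReal.eq_bot_iff_forall_lt _).2 fun M => ?_
  have hle : L1 a ≤ ((M - 1 : ℝ) : EReal) :=
    liminf_le_of_frequently_le ((h (M - 1)).mono fun _ hn => EReal.coe_le_coe_iff.2 hn.le)
  exact hle.trans_lt (EReal.coe_lt_coe_iff.2 (by linarith))

theorem L2_eq_top {a : ℕ → ℝ} (h : ∀ M : ℝ, ∃ᶠ n in atTop, M < a n) : L2 a = ⊤ := by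
  refine (EReal.eq_top_iff_forall_lt _).2 fun M => ?_
  have hle : ((M + 1 : ℝ) : EReal) ≤ L2 a :=
    le_limsup_of_frequently_le ((h (M + 1)).mono fun _ hn => EReal.coe_le_coe_iff.2 hn.le)
  exact (EReal.coe_lt_coe_iff.2 (by linarith)).trans_le hle

theorem not_mem_blockE_of_frequently_eq_zero {b : ℕ → ℝ} (h : ∃ᶠ n in atTop, b n = 0) :
    b ∉ blockE := by
  rintro ⟨-, hb⟩
  have h0 : ((0 : ℝ) : EReal) ≤ L2 b :=
    le_limsup_of_frequently_le (h.mono fun _ hn => EReal.coe_le_coe_iff.2 hn.ge)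
  exact EReal.coe_ne_bot 0 (le_bot_iff.1 (hb ▸ h0))

theorem not_mem_blockF_of_frequently_eq_zero {b : ℕ → ℝ} (h : ∃ᶠ n in atTop, b n = 0) :
    b ∉ blockF := by
  rintro ⟨hb, -⟩
  have h0 : L1 b ≤ ((0 : ℝ) : EReal) :=
    liminf_le_of_frequently_le (h.mono fun _ hn => EReal.coe_le_coe_iff.2 hn.le)
  exact EReal.coe_ne_top 0 (top_le_iff.1 (hb ▸ h0))

theorem hadamard_obstruction_of_frequently_eq_zero {a : ℕ → ℝ} (h : ∃ᶠ n in atTop, a n = 0)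
    (c : ℕ → ℝ) :
    ¬ Tendsto (fun n => a n * c n) atTop atTop ∧
    ¬ Tendsto (fun n => a n * c n) atTop atBot ∧
    (fun n => a n * c n) ∉ blockE ∧
    (fun n => a n * c n) ∉ blockF := by
  have h0 : ∃ᶠ n in atTop, a n * c n = 0 := h.mono fun n hn => by simp [hn]
  refine ⟨fun ht => ?_, fun ht => ?_, not_mem_blockE_of_frequently_eq_zero h0,
    not_mem_blockF_of_frequently_eq_zero h0⟩
  · obtain ⟨n, hn, hn'⟩ := (h0.and_eventually (ht.eventually_gt_atTop 0)).exists
    exact hn'.ne' hn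
  · obtain ⟨n, hn, hn'⟩ := (h0.and_eventually (ht.eventually_lt_atBot 0)).exists
    exact hn'.ne hn

/-- The sequence that interleaves the zero sequence with `u` and `v`. -/
def interleaveZero (u v : ℕ → ℝ) (n : ℕ) : ℝ :=
  if n % 3 = 0 then 0 else if n % 3 = 1 then u n else v n

theorem interleaveZero_cases {u v : ℕ → ℝ} {p : ℝ → Prop} (h0 : p 0) (hu : ∀ n, p (u n))
    (hv : ∀ n, p (v n)) (n : ℕ) : p (interleaveZero u v n) := by
  unfold interleaveZero
  split_ifs
  exacts [h0, hu n, hv n]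

theorem frequently_interleaveZero_eq_zero (u v : ℕ → ℝ) :
    ∃ᶠ n in atTop, interleaveZero u v n = 0 :=
  frequently_atTop.2 fun N => ⟨3 * N, by omega, by simp [interleaveZero]⟩

theorem frequently_interleaveZero_left {u v : ℕ → ℝ} {p : ℝ → Prop}
    (h : ∀ᶠ n in atTop, p (u n)) : ∃ᶠ n in atTop, p (interleaveZero u v n) := by
  obtain ⟨K, hK⟩ := eventually_atTop.1 h
  refine frequently_atTop.2 fun N => ⟨3 * (N + K) + 1, by omega, ?_⟩
  have hmod : (3 * (N + K) + 1) % 3 = 1 := by omega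
  simpa [interleaveZero, hmod] using hK (3 * (N + K) + 1) (by omega)

theorem frequently_interleaveZero_right {u v : ℕ → ℝ} {p : ℝ → Prop}
    (h : ∀ᶠ n in atTop, p (v n)) : ∃ᶠ n in atTop, p (interleaveZero u v n) := by
  obtain ⟨K, hK⟩ := eventually_atTop.1 h
  refine frequently_atTop.2 fun N => ⟨3 * (N + K) + 2, by omega, ?_⟩
  have hmod : (3 * (N + K) + 2) % 3 = 2 := by omega
  simpa [interleaveZero, hmod] using hK (3 * (N + K) + 2) (by omega)

theorem exists_mem_frequently_eq_zero :
    ∀ X ∈ ({blockA, blockB, blockC, blockD, blockG} : Set (Set (ℕ → ℝ))),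
      ∃ a ∈ X, ∃ᶠ n in atTop, a n = 0 := by
  have htop : Tendsto (fun n : ℕ => (n : ℝ)) atTop atTop := tendsto_natCast_atTop_atTop
  have hbot : Tendsto (fun n : ℕ => -(n : ℝ)) atTop atBot := tendsto_neg_atTop_atBot.comp htop
  have hz := frequently_interleaveZero_eq_zero
  rintro X (rfl | rfl | rfl | rfl | rfl)
  · exact ⟨interleaveZero (fun n => -(n : ℝ)) (fun _ => 0),
      ⟨L1_eq_bot fun M => frequently_interleaveZero_left (p := (· < M))
        (hbot.eventually_lt_atBot M),
        0, L2_eq_coe (interleaveZero_cases (p := (· ≤ 0)) le_rfl (by simp) (by simp))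
          ((hz _ _).mono fun _ hn => hn.ge)⟩, hz _ _⟩
  · exact ⟨interleaveZero (fun _ => 1) (fun _ => 1),
      ⟨0, 1,
        L1_eq_coe (interleaveZero_cases (p := (0 ≤ ·)) le_rfl (by simp) (by simp))
          ((hz _ _).mono fun _ hn => hn.le),
        L2_eq_coe (interleaveZero_cases (p := (· ≤ 1)) zero_le_one (by simp) (by simp))
          (frequently_interleaveZero_left (p := (1 ≤ ·)) (by simp)),
        zero_lt_one⟩, hz _ _⟩
  · exact ⟨interleaveZero (fun n => (n : ℝ)) (fun _ => 0),
      ⟨⟨0, L1_eq_coe (interleaveZero_cases (p := (0 ≤ ·)) le_rfl (by simp) (by simp))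
          ((hz _ _).mono fun _ hn => hn.le)⟩,
        L2_eq_top fun M => frequently_interleaveZero_left (p := (M < ·))
          (htop.eventually_gt_atTop M)⟩, hz _ _⟩
  · exact ⟨interleaveZero (fun n => (n : ℝ)) (fun n => -(n : ℝ)),
      ⟨L1_eq_bot fun M => frequently_interleaveZero_right (p := (· < M))
        (hbot.eventually_lt_atBot M),
        L2_eq_top fun M => frequently_interleaveZero_left (p := (M < ·))
          (htop.eventually_gt_atTop M)⟩, hz _ _⟩
  · have h0 : ∃ᶠ _ in (atTop : Filter ℕ), (0 : ℝ) = 0 := Frequently.of_forall fun _ => rfl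
    exact ⟨fun _ => 0,
      ⟨0, L1_eq_coe (fun _ => le_rfl) (h0.mono fun _ hn => hn.le),
        L2_eq_coe (fun _ => le_rfl) (h0.mono fun _ hn => hn.ge)⟩, h0⟩

theorem stmt14 :
    ∀ X ∈ ({blockA, blockB, blockC, blockD, blockG} : Set (Set (ℕ → ℝ))),
      (∃ a ∈ X, ∀ c : ℕ → ℝ,
        ¬ Tendsto (fun n => a n * c n) atTop atTop ∧
        ¬ Tendsto (fun n => a n * c n) atTop atBot ∧
        (fun n => a n * c n) ∉ blockE ∧
        (fun n => a n * c n) ∉ blockF) ∧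
      ¬ (∀ a ∈ X, ∃ c : ℕ → ℝ, (fun n => a n * c n) ∈ blockE) ∧
      ¬ (∀ a ∈ X, ∃ c : ℕ → ℝ, (fun n => a n * c n) ∈ blockF) := by
  intro X hX
  obtain ⟨a, ha, hz⟩ := exists_mem_frequently_eq_zero X hX
  have key := hadamard_obstruction_of_frequently_eq_zero hz
  refine ⟨⟨a, ha, key⟩, fun h => ?_, fun h => ?_⟩
  · obtain ⟨c, hc⟩ := h a ha
    exact (key c).2.2.1 hc
  · obtain ⟨c, hc⟩ := h a ha
    exact (key c).2.2.2 hc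
end
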